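/- arXiv:1701.04180 — 2 statements merged into one kernel-verified Lean document; each statement's English description precedes it below -/
import Mathlib

section
/- The Hamming weight distribution of the code C_{40,1}^{SE} = ρ_C(E_10) is: A_0 = 1, A_8 = 285 = A_32, A_10 = 1024 = A_30, A_12 = 11040 = A_28, A_14 = 46080 = A_26, A_16 = 117090 = A_24, A_18 = 215040 = A_22, A_20 = 267456, A_40 = 1, and A_w = 0 for all other weights w, where A_w denotes the number of codewords of Hamming weight w. -/
open scoped BigOperators

section Defs

variable {F : Type} [Field F] [DecidableEq F]

/-- The binary coordinate in column `j` (0-indexed), row `k`. -/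
def idx (j : Fin 10) (k : Fin 4) : Fin 40 :=
  ⟨4 * j.val + k.val, by have := j.isLt; have := k.isLt; omega⟩

/-- The map φ : GF(4) → 𝔽₂⁴, 0↦0000, 1↦0011, ω↦0101, ϖ↦0110. -/
def phi (ω : F) : F → (Fin 4 → ZMod 2) := fun x =>
  if x = 0 then ![0, 0, 0, 0]
  else if x = 1 then ![0, 0, 1, 1]
  else if x = ω then ![0, 1, 0, 1]
  else ![0, 1, 1, 0]

/-- Ĉ : the image of a quaternary code under coordinatewise φ. -/
def hatSet (ω : F) (C : Set (Fin 10 → F)) : Set (Fin 40 → ZMod 2) :=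
  { v | ∃ c ∈ C, ∀ (j : Fin 10) (k : Fin 4), v (idx j k) = phi ω (c j) k }

/-- d₄¹⁰ : binary vectors of length 40 constant on each of the ten columns. -/
def d4ten : Set (Fin 40 → ZMod 2) :=
  { v | ∀ (j : Fin 10) (k k' : Fin 4), v (idx j k) = v (idx j k') }

/-- (d₄¹⁰)₀ : the subcode of d₄¹⁰ of codewords of weight divisible by 8. -/
def d4ten0 : Set (Fin 40 → ZMod 2) :=
  { v | v ∈ d4ten ∧ 8 ∣ hammingNorm v }

/-- The generator 1000 1000 ... 1000 of e_C. -/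
def eCvec : Fin 40 → ZMod 2 := fun i => if i.val % 4 = 0 then 1 else 0

/-- The generator 1000 (×9) 0111 of e_B. -/
def eBvec : Fin 40 → ZMod 2 := fun i =>
  if i.val < 36 then (if i.val % 4 = 0 then 1 else 0)
  else (if i.val % 4 = 0 then 0 else 1)

/-- ρ_C(C) = Ĉ + (d₄¹⁰)₀ + e_C. -/
def rhoC (ω : F) (C : Set (Fin 10 → F)) : Set (Fin 40 → ZMod 2) :=
  { v | ∃ a ∈ hatSet ω C, ∃ b ∈ d4ten0,
      ∃ e ∈ ({0, eCvec} : Set (Fin 40 → ZMod 2)), v = a + b + e }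

/-- ρ_B(C) = Ĉ + (d₄¹⁰)₀ + e_B. -/
def rhoB (ω : F) (C : Set (Fin 10 → F)) : Set (Fin 40 → ZMod 2) :=
  { v | ∃ a ∈ hatSet ω C, ∃ b ∈ d4ten0,
      ∃ e ∈ ({0, eBvec} : Set (Fin 40 → ZMod 2)), v = a + b + e }

/-- The trace inner product x⋆y = Σ Tr(xᵢ ȳᵢ), computed in GF(4) (its value lies
in the prime subfield GF(2)). -/
def traceIP (x y : Fin 10 → F) : F :=
  ∑ i, ((x i * (y i) ^ 2) + (x i * (y i) ^ 2) ^ 2)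

/-- The dual of an additive code with respect to the trace inner product. -/
def addDual (C : Set (Fin 10 → F)) : Set (Fin 10 → F) :=
  { x | ∀ c ∈ C, traceIP x c = 0 }

/-- The dual of a binary code of length 40 under the standard inner product. -/
def binDual (S : Set (Fin 40 → ZMod 2)) : Set (Fin 40 → ZMod 2) :=
  { x | ∀ c ∈ S, ∑ i, x i * c i = 0 }

/-- The dual of a quaternary code under the Hermitian inner product ⟨x,y⟩ = Σ xᵢ ȳᵢ. -/
def hermDual (S : Set (Fin 10 → F)) : Set (Fin 10 → F) :=
  { x | ∀ c ∈ S, ∑ i, x i * (c i) ^ 2 = 0 }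

/-- The Hermitian self-dual [10,5,4] code E₁₀ over GF(4). -/
def E10 (ω : F) : Submodule F (Fin 10 → F) :=
  Submodule.span F {![1,1,1,1,0,0,0,0,0,0], ![0,0,1,1,1,1,0,0,0,0],
    ![0,0,0,0,1,1,1,1,0,0], ![0,0,0,0,0,0,1,1,1,1],
    ![1,0,1,0,1,0,1,0,ω,ω^2]}

/-- The Hermitian self-dual [10,5,4] code B₁₀ over GF(4). -/
def B10 (ω : F) : Submodule F (Fin 10 → F) :=
  Submodule.span F {![1,1,1,1,0,0,0,0,0,0], ![0,1,ω,ω^2,1,0,0,0,0,0],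
    ![0,0,0,0,0,1,1,1,1,0], ![0,0,0,0,0,0,1,ω,ω^2,1],
    ![0,1,ω^2,ω,0,0,1,ω^2,ω,0]}

/-- Interpret a bit as an element of GF(4). -/
def b2f (x : ZMod 2) : F := if x = 1 then 1 else 0

/-- The projection 𝔽₂⁴⁰ → GF(4)¹⁰ : column j ↦ v₂ᵢₙ·1 + v·ω + v·ϖ with row labels 0,1,ω,ϖ. -/
def Proj (ω : F) (v : Fin 40 → ZMod 2) : Fin 10 → F := fun j =>
  b2f (v (idx j 1)) * 1 + b2f (v (idx j 2)) * ω + b2f (v (idx j 3)) * ω ^ 2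

/-- The parity of column j (1 = odd number of ones). -/
def colPar (v : Fin 40 → ZMod 2) (j : Fin 10) : ZMod 2 := ∑ k, v (idx j k)

/-- The parity of the top row (1 = odd number of ones). -/
def topPar (v : Fin 40 → ZMod 2) : ZMod 2 := ∑ j, v (idx j 0)

/-- The coordinate permutation of Fin 10 permuting the five blocks {2m, 2m+1}
as units according to π, preserving order within blocks. -/
def blockPerm (π : Equiv.Perm (Fin 5)) : Fin 10 → Fin 10 := fun t =>
  ⟨2 * (π ⟨t.val / 2, by have := t.isLt; omega⟩).val + t.val % 2, by
    have := (π ⟨t.val / 2, by have := t.isLt; omega⟩).isLt; have := t.isLt; omega⟩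

/-- The coordinate permutation of Fin 10 interchanging the two coordinates within
each block belonging to S, fixing all other coordinates. -/
def blockSwap (S : Finset (Fin 5)) : Fin 10 → Fin 10 := fun t =>
  if (⟨t.val / 2, by have := t.isLt; omega⟩ : Fin 5) ∈ S then
    ⟨2 * (t.val / 2) + (1 - t.val % 2), by have := t.isLt; omega⟩
  else t

end Defs

lemma zmodTwo_eq_zero_or_one : ∀ t : ZMod 2, t = 0 ∨ t = 1 := by decide

lemma sum_zmodTwo {M : Type*} [AddCommMonoid M] (g : ZMod 2 → M) : ∑ t, g t = g 0 + g 1 :=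
  Fin.sum_univ_two g

/-- The additive group of GF(4), with `(p, q)` standing for `p + q ω`. -/
abbrev Quat : Type := ZMod 2 × ZMod 2

/-- Multiplication by `ω` on `Quat`. -/
def mulOmega (x : Quat) : Quat := (x.2, x.1 + x.2)

/-- The encoder of `E10` in the coordinates `Quat`. -/
def encE10 (x : Quat × Quat × Quat × Quat × Quat) : Fin 10 → Quat :=
  match x with
  | (a, b, c, d, e) =>
    ![a + e, a, a + b + e, a + b, b + c + e, b + c, c + d + e, c + d,
      d + mulOmega e, d + (e + mulOmega e)]

/-- The weight of a single coordinate. -/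
def coordWt (y : Quat) : ℕ := if y = 0 then 0 else 1

/-- The number of nonzero coordinates of `encE10 x`, in a form that evaluates quickly. -/
def wtE10 (x : Quat × Quat × Quat × Quat × Quat) : ℕ :=
  match x with
  | (a, b, c, d, e) =>
    coordWt (a + e) + coordWt a + coordWt (a + b + e) + coordWt (a + b) +
      coordWt (b + c + e) + coordWt (b + c) + coordWt (c + d + e) + coordWt (c + d) +
      coordWt (d + mulOmega e) + coordWt (d + (e + mulOmega e))

lemma hammingNorm_encE10 (x : Quat × Quat × Quat × Quat × Quat) :
    hammingNorm (encE10 x) = wtE10 x := by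
  obtain ⟨a, b, c, d, e⟩ := x
  have h : ∀ y : Fin 10 → Quat, hammingNorm y = ∑ j, coordWt (y j) := by
    intro y
    rw [hammingNorm, Finset.card_filter]
    exact Finset.sum_congr rfl fun j _ => ite_not ..
  rw [h]
  simp only [Fin.sum_univ_succ, Fin.sum_univ_zero, encE10, wtE10]
  simp
  omega

/-- The map `phi` in the coordinates `Quat`. -/
def phiQuat (y : Quat) : Fin 4 → ZMod 2 := ![0, y.2, y.1, y.1 + y.2]

lemma encE10_injective : Function.Injective encE10 := by
  rintro ⟨a, b, c, d, e⟩ ⟨a', b', c', d', e'⟩ h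
  have h0 := congrFun h 0
  have h1 := congrFun h 1
  have h3 := congrFun h 3
  have h5 := congrFun h 5
  have h7 := congrFun h 7
  simp [encE10] at h0 h1 h3 h5 h7
  subst h1
  simp_all

lemma sum_wtE10 {M : Type*} [AddCommMonoid M] (g : ℕ → M) :
    ∑ x, g (wtE10 x) = g 0 + 30 • g 4 + 300 • g 6 + 585 • g 8 + 108 • g 10 := by
  have hmem : ∀ x, wtE10 x ∈ ({0, 4, 6, 8, 10} : Finset ℕ) := by decide +kernel
  have h0 : (Finset.univ.filter fun x => wtE10 x = 0).card = 1 := by decide +kernel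
  have h4 : (Finset.univ.filter fun x => wtE10 x = 4).card = 30 := by decide +kernel
  have h6 : (Finset.univ.filter fun x => wtE10 x = 6).card = 300 := by decide +kernel
  have h8 : (Finset.univ.filter fun x => wtE10 x = 8).card = 585 := by decide +kernel
  have h10 : (Finset.univ.filter fun x => wtE10 x = 10).card = 108 := by decide +kernel
  rw [← Finset.sum_fiberwise_of_maps_to' (fun x _ => hmem x)]
  simp [Finset.sum_const, h0, h4, h6, h8, h10, add_assoc]

section Field

variable {F : Type} [Field F]

/-- The additive map `(p, q) ↦ p + q ω`. -/
def quatVal (ω : F) (x : Quat) : F :=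
  (if x.1 = 0 then 0 else 1) + (if x.2 = 0 then 0 else ω)

lemma quatVal_add [CharP F 2] (ω : F) (x y : Quat) :
    quatVal ω (x + y) = quatVal ω x + quatVal ω y := by
  have h2 : (2 : F) = 0 := CharTwo.two_eq_zero
  obtain ⟨p, q⟩ := x
  obtain ⟨p', q'⟩ := y
  rcases zmodTwo_eq_zero_or_one p with rfl | rfl <;>
    rcases zmodTwo_eq_zero_or_one q with rfl | rfl <;>
    rcases zmodTwo_eq_zero_or_one p' with rfl | rfl <;>
    rcases zmodTwo_eq_zero_or_one q' with rfl | rfl <;>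
    simp [quatVal, CharTwo.add_self_eq_zero] <;> grind

lemma quatVal_mulOmega [CharP F 2] {ω : F} (hω : ω ^ 2 = ω + 1) (x : Quat) :
    quatVal ω (mulOmega x) = ω * quatVal ω x := by
  have h2 : (2 : F) = 0 := CharTwo.two_eq_zero
  obtain ⟨p, q⟩ := x
  rcases zmodTwo_eq_zero_or_one p with rfl | rfl <;> rcases zmodTwo_eq_zero_or_one q with rfl | rfl <;>
    simp [quatVal, mulOmega] <;> grind

lemma quatVal_injective [CharP F 2] {ω : F} (hω : ω ^ 2 = ω + 1) :
    Function.Injective (quatVal ω) := by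
  have h2 : (2 : F) = 0 := CharTwo.two_eq_zero
  rintro ⟨p, q⟩ ⟨p', q'⟩
  rcases zmodTwo_eq_zero_or_one p with rfl | rfl <;>
    rcases zmodTwo_eq_zero_or_one q with rfl | rfl <;>
    rcases zmodTwo_eq_zero_or_one p' with rfl | rfl <;>
    rcases zmodTwo_eq_zero_or_one q' with rfl | rfl <;>
    simp [quatVal] <;> grind

lemma quatVal_bijective [CharP F 2] [Fintype F] (hF : Fintype.card F = 4) {ω : F}
    (hω : ω ^ 2 = ω + 1) : Function.Bijective (quatVal ω) :=
  (Fintype.bijective_iff_injective_and_card _).2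
    ⟨quatVal_injective hω, by rw [hF]; rfl⟩

lemma phi_quatVal [CharP F 2] [DecidableEq F] {ω : F} (hω : ω ^ 2 = ω + 1) (y : Quat) :
    phi ω (quatVal ω y) = phiQuat y := by
  have h2 : (2 : F) = 0 := CharTwo.two_eq_zero
  have h0 : ω ≠ 0 := by rintro rfl; simp at hω
  have h1 : ω ≠ 1 := by rintro rfl; grind
  have h3 : 1 + ω ≠ 0 := by rw [add_comm, ← hω]; exact pow_ne_zero 2 h0
  obtain ⟨p, q⟩ := y
  rcases zmodTwo_eq_zero_or_one p with rfl | rfl <;> rcases zmodTwo_eq_zero_or_one q with rfl | rfl <;>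
    simp [quatVal, phiQuat, phi, h0, h1, h3]
  decide

lemma mem_E10_iff [CharP F 2] [Fintype F] (hF : Fintype.card F = 4) {ω : F}
    (hω : ω ^ 2 = ω + 1) (v : Fin 10 → F) :
    v ∈ E10 ω ↔ ∃ x, v = fun j => quatVal ω (encE10 x j) := by
  have key : ∀ a b c d e : Quat, (fun j => quatVal ω (encE10 (a, b, c, d, e) j)) =
      quatVal ω a • ![1,1,1,1,0,0,0,0,0,0] + (quatVal ω b • ![0,0,1,1,1,1,0,0,0,0] +
        (quatVal ω c • ![0,0,0,0,1,1,1,1,0,0] + (quatVal ω d • ![0,0,0,0,0,0,1,1,1,1] +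
          quatVal ω e • ![1,0,1,0,1,0,1,0,ω,ω^2]))) := by
    intro a b c d e
    ext j
    fin_cases j <;> simp [encE10, quatVal_add, quatVal_mulOmega hω, hω] <;> ring
  have hs := (quatVal_bijective hF hω).surjective
  simp only [E10, Submodule.mem_span_insert, Submodule.mem_span_singleton]
  constructor
  · rintro ⟨a, _, ⟨b, _, ⟨c, _, ⟨d, _, ⟨e, rfl⟩, rfl⟩, rfl⟩, rfl⟩, rfl⟩
    obtain ⟨a, rfl⟩ := hs a
    obtain ⟨b, rfl⟩ := hs b
    obtain ⟨c, rfl⟩ := hs c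
    obtain ⟨d, rfl⟩ := hs d
    obtain ⟨e, rfl⟩ := hs e
    exact ⟨(a, b, c, d, e), (key a b c d e).symm⟩
  · rintro ⟨⟨a, b, c, d, e⟩, rfl⟩
    exact ⟨_, _, ⟨_, _, ⟨_, _, ⟨_, _, ⟨_, rfl⟩, rfl⟩, rfl⟩, rfl⟩, key a b c d e⟩

end Field

lemma exists_idx (i : Fin 40) : ∃ j k, i = idx j k :=
  ⟨⟨i / 4, by omega⟩, ⟨i % 4, by omega⟩, by ext; simp [idx]; omega⟩

lemma ext_idx {v w : Fin 40 → ZMod 2} (h : ∀ j k, v (idx j k) = w (idx j k)) : v = w := by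
  ext1 i
  obtain ⟨j, k, rfl⟩ := exists_idx i
  exact h j k

/-- The binary vector with prescribed columns. -/
def ofColumns (f : Fin 10 → Fin 4 → ZMod 2) : Fin 40 → ZMod 2 :=
  fun i => f ⟨i / 4, by omega⟩ ⟨i % 4, by omega⟩

lemma ofColumns_idx (f : Fin 10 → Fin 4 → ZMod 2) (j : Fin 10) (k : Fin 4) :
    ofColumns f (idx j k) = f j k := by
  have hj : (⟨(idx j k).val / 4, by omega⟩ : Fin 10) = j := by ext; simp [idx]; omega
  have hk : (⟨(idx j k).val % 4, by omega⟩ : Fin 4) = k := by ext; simp [idx]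
  rw [ofColumns, hj, hk]

lemma hammingNorm_eq_sum_columns (v : Fin 40 → ZMod 2) :
    hammingNorm v = ∑ j, hammingNorm (fun k => v (idx j k)) := by
  have h : ∀ (n : ℕ) (u : Fin n → ZMod 2), hammingNorm u = ∑ i, if u i ≠ 0 then 1 else 0 := by
    intro n u
    rw [hammingNorm, Finset.card_filter]
  simp only [h]
  rw [← Fintype.sum_prod_type']
  refine (Fintype.sum_equiv (finProdFinEquiv (m := 10) (n := 4)) _ _ ?_).symm
  rintro ⟨j, k⟩
  have : finProdFinEquiv (m := 10) (n := 4) (j, k) = idx j k := by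
    ext
    simp only [idx, finProdFinEquiv_apply_val]
    omega
  rw [this]

/-- The column with quaternary label `y`, shift `t` and parity `e`. -/
def column (y : Quat) (t e : ZMod 2) : Fin 4 → ZMod 2 :=
  fun k => phiQuat y k + t + if k = 0 then e else 0

lemma column_injective (y y' : Quat) (t t' e e' : ZMod 2)
    (h : column y t e = column y' t' e') : y = y' ∧ t = t' ∧ e = e' := by
  revert y y' t t' e e'
  decide

/-- Parameters for the codewords of `rhoC ω (E10 ω)`. -/
abbrev Param : Type :=
  (Quat × Quat × Quat × Quat × Quat) × (Fin 10 → ZMod 2) × ZMod 2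

/-- The codeword with given parameters. -/
def codeword (p : Param) : Fin 40 → ZMod 2 :=
  ofColumns fun j => column (encE10 p.1 j) (p.2.1 j) p.2.2

lemma codeword_injective : Function.Injective codeword := by
  rintro ⟨x, s, e⟩ ⟨x', s', e'⟩ h
  have hc : ∀ j, column (encE10 x j) (s j) e = column (encE10 x' j) (s' j) e' := by
    intro j
    ext k
    simpa [codeword, ofColumns_idx] using congrFun h (idx j k)
  have hj := fun j => column_injective _ _ _ _ _ _ (hc j)
  have hx : x = x' := encE10_injective (funext fun j => (hj j).1)
  have hs : s = s' := funext fun j => (hj j).2.1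
  rw [hx, hs, (hj 0).2.2]

lemma eight_dvd_hammingNorm_iff (s : Fin 10 → ZMod 2) :
    8 ∣ hammingNorm (ofColumns fun j _ => s j) ↔ ∑ j, s j = 0 := by
  have h4 : ∀ t : ZMod 2, hammingNorm (fun _ : Fin 4 => t) = 4 * t.val := by decide
  simp only [hammingNorm_eq_sum_columns, ofColumns_idx, h4, ← Finset.mul_sum]
  rw [show (8 : ℕ) = 4 * 2 from rfl, Nat.mul_dvd_mul_iff_left (by norm_num),
    ← ZMod.natCast_eq_zero_iff]
  simp

lemma mem_rhoC_E10_iff {F : Type} [Field F] [Fintype F] [DecidableEq F] [CharP F 2]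
    (hF : Fintype.card F = 4) {ω : F} (hω : ω ^ 2 = ω + 1) (v : Fin 40 → ZMod 2) :
    v ∈ rhoC ω (E10 ω : Set (Fin 10 → F)) ↔
      ∃ p : Param, ∑ j, p.2.1 j = 0 ∧ codeword p = v := by
  have heC : ∀ j k, eCvec (idx j k) = if k = 0 then 1 else 0 := by decide
  constructor
  · rintro ⟨a, ⟨c, hc, ha⟩, b, ⟨hb, hb8⟩, e, he, rfl⟩
    obtain ⟨x, rfl⟩ := (mem_E10_iff hF hω c).1 hc
    simp only [phi_quatVal hω] at ha
    have hb' : b = ofColumns fun j _ => b (idx j 0) :=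
      ext_idx fun j k => by rw [ofColumns_idx]; exact hb j k 0
    rw [hb', eight_dvd_hammingNorm_iff] at hb8
    obtain ⟨ε, hε⟩ : ∃ ε : ZMod 2, ∀ j k, e (idx j k) = if k = 0 then ε else 0 := by
      rcases he with rfl | rfl
      · exact ⟨0, by simp⟩
      · exact ⟨1, heC⟩
    refine ⟨(x, fun j => b (idx j 0), ε), hb8, ext_idx fun j k => ?_⟩
    simp [codeword, ofColumns_idx, column, ha, hε, hb j k 0]
  · rintro ⟨⟨x, s, e⟩, hs, rfl⟩
    refine ⟨ofColumns fun j => phiQuat (encE10 x j), ⟨_, (mem_E10_iff hF hω _).2 ⟨x, rfl⟩, ?_⟩,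
      ofColumns fun j _ => s j, ⟨?_, (eight_dvd_hammingNorm_iff s).2 hs⟩,
      if e = 0 then 0 else eCvec, ?_, ?_⟩
    · intro j k
      rw [ofColumns_idx, phi_quatVal hω]
    · intro j k k'
      simp only [ofColumns_idx]
    · split_ifs <;> simp
    · refine ext_idx fun j k => ?_
      rcases zmodTwo_eq_zero_or_one e with rfl | rfl <;>
        simp [codeword, ofColumns_idx, column, heC]

/-- Twice the weight enumerator, at `x`, of the words with prescribed labels and parity. -/
lemma two_mul_sum_column {R : Type*} [CommRing R] (x : R) (y : Fin 10 → Quat) (e : ZMod 2) :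
    2 * ∑ s : Fin 10 → ZMod 2 with ∑ j, s j = 0,
        x ^ ∑ j, hammingNorm (column (y j) (s j) e) =
      ∏ j, (x ^ hammingNorm (column (y j) 0 e) + x ^ hammingNorm (column (y j) 1 e)) +
      ∏ j, (x ^ hammingNorm (column (y j) 0 e) - x ^ hammingNorm (column (y j) 1 e)) := by
  let χ : ZMod 2 → R := fun t => if t = 0 then 1 else -1
  have hχ : ∀ s : Fin 10 → ZMod 2, ∏ j, χ (s j) = χ (∑ j, s j) := by
    have hadd : ∀ t u, χ (t + u) = χ t * χ u := by
      intro t u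
      rcases zmodTwo_eq_zero_or_one t with rfl | rfl <;>
        rcases zmodTwo_eq_zero_or_one u with rfl | rfl <;>
        simp [χ, CharTwo.add_self_eq_zero]
    intro s
    exact (map_prod (⟨⟨fun t => χ t.toAdd, rfl⟩, fun t u => hadd _ _⟩ :
      Multiplicative (ZMod 2) →* R) (fun j => Multiplicative.ofAdd (s j)) _).symm
  have hp : ∀ g : Fin 10 → ZMod 2 → R,
      ∏ j, (g j 0 + g j 1) = ∑ s : Fin 10 → ZMod 2, ∏ j, g j (s j) := by
    intro g
    rw [← Fintype.piFinset_univ, ← Finset.prod_univ_sum]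
    exact Finset.prod_congr rfl fun j _ => (sum_zmodTwo (g j)).symm
  have h1 := hp fun j t => x ^ hammingNorm (column (y j) t e)
  have h2 := hp fun j t => χ t * x ^ hammingNorm (column (y j) t e)
  have hχ0 : χ 0 = 1 := rfl
  have hχ1 : χ 1 = -1 := rfl
  simp only [hχ0, hχ1, one_mul, neg_one_mul, ← sub_eq_add_neg] at h2
  rw [h1, h2, ← Finset.sum_add_distrib, Finset.sum_filter, Finset.mul_sum]
  refine Finset.sum_congr rfl fun s _ => ?_
  rw [Finset.prod_mul_distrib, hχ, Finset.prod_pow_eq_pow_sum]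
  split_ifs with h
  · rw [h, hχ0]; ring
  · simp [χ, h]

lemma prod_ite_eq_pow_hammingNorm {R : Type*} [CommMonoid R] (y : Fin 10 → Quat) (a b : R) :
    ∏ j, (if y j = 0 then a else b) = a ^ (10 - hammingNorm y) * b ^ hammingNorm y := by
  rw [Finset.prod_ite, Finset.prod_const, Finset.prod_const]
  have h := Finset.card_filter_add_card_filter_not (s := Finset.univ) (fun j => y j = 0)
  simp only [Finset.card_univ, Fintype.card_fin] at h
  have : hammingNorm y = (Finset.univ.filter fun j => ¬ y j = 0).card := rfl
  rw [this]
  congr 2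
  omega

lemma hammingNorm_column (y : Quat) (t e : ZMod 2) : hammingNorm (column y t e) =
    if e = 0 then (if y = 0 then 4 * t.val else 2)
    else (if y = 0 then 1 + 2 * t.val else 3 - 2 * t.val) := by
  revert y t e
  decide

lemma hammingNorm_codeword (p : Param) :
    hammingNorm (codeword p) = ∑ j, hammingNorm (column (encE10 p.1 j) (p.2.1 j) p.2.2) := by
  simp only [hammingNorm_eq_sum_columns, codeword, ofColumns_idx]

/-- Twice the weight enumerator, at `x`, of the words over a quaternary word of weight `m`. -/
def fiberEnumerator {R : Type*} [CommRing R] (x : R) (m : ℕ) : R :=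
  (1 + x ^ 4) ^ (10 - m) * (2 * x ^ 2) ^ m + (1 - x ^ 4) ^ (10 - m) * 0 ^ m +
    ((x + x ^ 3) ^ 10 + (x - x ^ 3) ^ (10 - m) * (x ^ 3 - x) ^ m)

lemma two_mul_sum_fiber {R : Type*} [CommRing R] (x : R) (y : Fin 10 → Quat) :
    2 * ∑ e : ZMod 2, ∑ s : Fin 10 → ZMod 2 with ∑ j, s j = 0,
      x ^ ∑ j, hammingNorm (column (y j) (s j) e) =
      fiberEnumerator x (hammingNorm y) := by
  have h0 : ∀ y, x ^ hammingNorm (column y 0 0) + x ^ hammingNorm (column y 1 0) =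
      if y = 0 then 1 + x ^ 4 else 2 * x ^ 2 := by
    intro y; split_ifs with h <;> simp [hammingNorm_column, h, ZMod.val_one, two_mul]
  have h1 : ∀ y, x ^ hammingNorm (column y 0 0) - x ^ hammingNorm (column y 1 0) =
      if y = 0 then 1 - x ^ 4 else 0 := by
    intro y; split_ifs with h <;> simp [hammingNorm_column, h, ZMod.val_one]
  have h2 : ∀ y, x ^ hammingNorm (column y 0 1) + x ^ hammingNorm (column y 1 1) =
      x + x ^ 3 := by
    intro y; by_cases h : y = 0 <;> simp [hammingNorm_column, h, ZMod.val_one, add_comm]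
  have h3 : ∀ y, x ^ hammingNorm (column y 0 1) - x ^ hammingNorm (column y 1 1) =
      if y = 0 then x - x ^ 3 else x ^ 3 - x := by
    intro y; split_ifs with h <;> simp [hammingNorm_column, h, ZMod.val_one]
  rw [sum_zmodTwo, mul_add, two_mul_sum_column, two_mul_sum_column]
  simp only [h0, h1, h2, h3, prod_ite_eq_pow_hammingNorm, Finset.prod_const, Finset.card_univ,
    Fintype.card_fin, fiberEnumerator]

lemma sum_filter_param {M : Type*} [AddCommMonoid M] (f : Param → M) :
    ∑ p : Param with ∑ j, p.2.1 j = 0, f p =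
      ∑ x, ∑ e : ZMod 2, ∑ s : Fin 10 → ZMod 2 with ∑ j, s j = 0, f (x, s, e) := by
  rw [Finset.sum_filter, Fintype.sum_prod_type]
  refine Finset.sum_congr rfl fun x _ => ?_
  rw [Fintype.sum_prod_type_right]
  refine Finset.sum_congr rfl fun e _ => ?_
  rw [Finset.sum_filter]

lemma fiberEnumerator_combination {R : Type*} [CommRing R] (x : R) :
    fiberEnumerator x 0 + 30 * fiberEnumerator x 4 + 300 * fiberEnumerator x 6 +
        585 * fiberEnumerator x 8 + 108 * fiberEnumerator x 10 =
      2 * (1 + 285 * x ^ 8 + 1024 * x ^ 10 + 11040 * x ^ 12 + 46080 * x ^ 14 + 117090 * x ^ 16 +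
        215040 * x ^ 18 + 267456 * x ^ 20 + 215040 * x ^ 22 + 117090 * x ^ 24 +
        46080 * x ^ 26 + 11040 * x ^ 28 + 1024 * x ^ 30 + 285 * x ^ 32 + x ^ 40) := by
  simp only [fiberEnumerator]
  norm_num
  ring

lemma sum_fiberEnumerator {R : Type*} [CommRing R] (x : R) :
    ∑ c, fiberEnumerator x (wtE10 c) =
      2 * (1 + 285 * x ^ 8 + 1024 * x ^ 10 + 11040 * x ^ 12 + 46080 * x ^ 14 + 117090 * x ^ 16 +
        215040 * x ^ 18 + 267456 * x ^ 20 + 215040 * x ^ 22 + 117090 * x ^ 24 +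
        46080 * x ^ 26 + 11040 * x ^ 28 + 1024 * x ^ 30 + 285 * x ^ 32 + x ^ 40) := by
  refine Eq.trans ?_ (fiberEnumerator_combination x)
  rw [sum_wtE10]
  simp only [nsmul_eq_mul, Nat.cast_ofNat]

lemma two_mul_sum_codeword {R : Type*} [CommRing R] (x : R) :
    2 * ∑ p : Param with ∑ j, p.2.1 j = 0, x ^ hammingNorm (codeword p) =
      ∑ c, fiberEnumerator x (wtE10 c) := by
  rw [sum_filter_param, Finset.mul_sum]
  refine Finset.sum_congr rfl fun c _ => ?_
  simp only [hammingNorm_codeword]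
  rw [← hammingNorm_encE10]
  exact two_mul_sum_fiber x (encE10 c)

lemma weight_enumerator {R : Type*} [CommRing R] [IsDomain R] [CharZero R] (x : R) :
    ∑ p : Param with ∑ j, p.2.1 j = 0, x ^ hammingNorm (codeword p) =
      1 + 285 * x ^ 8 + 1024 * x ^ 10 + 11040 * x ^ 12 + 46080 * x ^ 14 + 117090 * x ^ 16 +
        215040 * x ^ 18 + 267456 * x ^ 20 + 215040 * x ^ 22 + 117090 * x ^ 24 +
        46080 * x ^ 26 + 11040 * x ^ 28 + 1024 * x ^ 30 + 285 * x ^ 32 + x ^ 40 := by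
  refine mul_left_cancel₀ (two_ne_zero (α := R)) ?_
  rw [two_mul_sum_codeword, sum_fiberEnumerator]

/-- The weight distribution of C₄₀,₁ˢᴱ = ρ_C(E₁₀). -/
theorem stmt_16 (F : Type) [Field F] [Fintype F] [DecidableEq F]
    (hF : Fintype.card F = 4) (ω : F) (hω : ω ^ 2 = ω + 1) :
    ∀ w : ℕ,
      Nat.card {v : Fin 40 → ZMod 2 //
          v ∈ rhoC ω (E10 ω : Set (Fin 10 → F)) ∧ hammingNorm v = w} =
        if w = 0 then 1
        else if w = 8 then 285
        else if w = 10 then 1024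
        else if w = 12 then 11040
        else if w = 14 then 46080
        else if w = 16 then 117090
        else if w = 18 then 215040
        else if w = 20 then 267456
        else if w = 22 then 215040
        else if w = 24 then 117090
        else if w = 26 then 46080
        else if w = 28 then 11040
        else if w = 30 then 1024
        else if w = 32 then 285
        else if w = 40 then 1
        else 0 := by
  classical
  intro w
  have : CharP F 2 := by
    refine CharTwo.of_one_ne_zero_of_two_eq_zero one_ne_zero ?_
    have h : ((4 : ℕ) : F) = 0 := hF ▸ Nat.cast_card_eq_zero F
    have h' : (2 : F) * 2 = 0 := by rw [← h]; norm_num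
    exact mul_self_eq_zero.1 h'
  have hcard : Nat.card {v : Fin 40 → ZMod 2 //
      v ∈ rhoC ω (E10 ω : Set (Fin 10 → F)) ∧ hammingNorm v = w} =
      ((Finset.univ.filter fun p : Param => ∑ j, p.2.1 j = 0).filter
        fun p => hammingNorm (codeword p) = w).card := by
    rw [← Finset.card_image_of_injective _ codeword_injective, Nat.subtype_card]
    intro v
    simp only [Finset.mem_image, Finset.mem_filter, Finset.mem_univ, true_and,
      mem_rhoC_E10_iff hF hω]
    constructor
    · rintro ⟨p, ⟨hp, hw⟩, rfl⟩
      exact ⟨⟨p, hp, rfl⟩, hw⟩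
    · rintro ⟨⟨p, hp, rfl⟩, hw⟩
      exact ⟨p, ⟨hp, hw⟩, rfl⟩
  have hcoeff := congrArg (fun P => Polynomial.coeff P w)
    (weight_enumerator (Polynomial.X : Polynomial ℤ))
  simp only [Polynomial.finsetSum_coeff, Polynomial.coeff_X_pow, eq_comm (a := w),
    Finset.sum_boole, ← hcard] at hcoeff
  rw [← Nat.cast_inj (R := ℤ), hcoeff]
  simp only [Polynomial.coeff_add, Polynomial.coeff_ofNat_mul, Polynomial.coeff_X_pow,
    Polynomial.coeff_one]
  by_cases hw : w ≤ 40
  · interval_cases w <;> rfl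
  · repeat rw [if_neg (by omega)]
    simp
end

section
/- The binary codes C_{40,1}^{DE} = ρ_B(E_10) and C_{40,2}^{DE} = ρ_B(B_10) are inequivalent: there is no permutation of the 40 coordinate positions that maps C_{40,1}^{DE} onto C_{40,2}^{DE}. -/
open scoped BigOperators

section Inequivalence

/-- The vector of length 40 with prescribed columns. -/
def ofCols (u : Fin 10 → Fin 4 → ZMod 2) : Fin 40 → ZMod 2 := fun i =>
  u ⟨i.val / 4, by have := i.isLt; omega⟩ ⟨i.val % 4, by omega⟩

lemma ofCols_idx (u : Fin 10 → Fin 4 → ZMod 2) (j : Fin 10) (k : Fin 4) :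
    ofCols u (idx j k) = u j k := by
  have hj : (4 * j.val + k.val) / 4 = j.val := by omega
  have hk : (4 * j.val + k.val) % 4 = k.val := by omega
  simp only [ofCols, idx, hj, hk]

lemma sum_eq_sum_columns {M : Type*} [AddCommMonoid M] (f : Fin 40 → M) :
    ∑ i, f i = ∑ j, ∑ k, f (idx j k) := by
  rw [← Fintype.sum_prod_type']
  refine (Fintype.sum_equiv (finProdFinEquiv (m := 10) (n := 4)) _ _ fun p => ?_).symm
  congr 1
  ext
  simp [idx, finProdFinEquiv, add_comm]

lemma hammingNorm_eq_sum {ι : Type*} [Fintype ι] (v : ι → ZMod 2) :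
    hammingNorm v = ∑ i, if v i ≠ 0 then 1 else 0 := by
  rw [hammingNorm, Finset.card_filter]

/-- `T` is orthogonal to all words of weight 8 in `S`. -/
def OrthOctads (S : Set (Fin 40 → ZMod 2)) (T : Fin 40 → ZMod 2) : Prop :=
  ∀ v ∈ S, hammingNorm v = 8 → ∑ i, v i * T i = 0

lemma hammingNorm_comp_perm (v : Fin 40 → ZMod 2) (σ : Equiv.Perm (Fin 40)) :
    hammingNorm (v ∘ σ) = hammingNorm v := by
  simp only [hammingNorm_eq_sum, Function.comp_apply]
  exact Equiv.sum_comp σ fun i => if v i ≠ 0 then 1 else 0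

lemma OrthOctads.comp_perm {S : Set (Fin 40 → ZMod 2)} {T : Fin 40 → ZMod 2}
    (h : OrthOctads S T) (σ : Equiv.Perm (Fin 40)) :
    OrthOctads ((fun v : Fin 40 → ZMod 2 => v ∘ σ) '' S) (T ∘ σ) := by
  rintro _ ⟨u, hu, rfl⟩ hw
  rw [← h u hu (by rwa [← hammingNorm_comp_perm u σ])]
  exact Equiv.sum_comp σ fun i => u i * T i

lemma hammingNorm_pos_of_odd : ∀ u : Fin 4 → ZMod 2, ∑ k, u k ≠ 0 → 1 ≤ hammingNorm u := by
  decide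

lemma constant_or_weight_two : ∀ u : Fin 4 → ZMod 2, ∑ k, u k = 0 →
    (∀ k k', u k = u k') ∨ hammingNorm u = 2 := by
  decide

lemma even_hammingNorm : ∀ u : Fin 4 → ZMod 2, ∑ k, u k = 0 → 2 ∣ hammingNorm u := by
  decide

lemma sum_mul_ne_zero_of_weight_two : ∀ u : Fin 4 → ZMod 2, ∑ k, u k = 0 → hammingNorm u = 2 →
    ∑ k, ![0, 0, 1, 1] k * u k ≠ 0 ∨ ∑ k, ![0, 1, 0, 1] k * u k ≠ 0 := by
  decide

lemma column_parity_add_eB : ∀ (a : Fin 4 → ZMod 2) (b : ZMod 2),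
    a = ![0, 0, 0, 0] ∨ a = ![0, 0, 1, 1] ∨ a = ![0, 1, 0, 1] ∨ a = ![0, 1, 1, 0] →
    ∑ k, (a k + b + ![1, 0, 0, 0] k) ≠ 0 ∧ ∑ k, (a k + b + ![0, 1, 1, 1] k) ≠ 0 := by
  decide

lemma column_weight_add_const : ∀ (a : Fin 4 → ZMod 2) (b : ZMod 2),
    a = ![0, 0, 1, 1] ∨ a = ![0, 1, 0, 1] ∨ a = ![0, 1, 1, 0] →
    hammingNorm (fun k => a k + b) = 2 := by
  decide

variable {F : Type} [Field F]

/-- The differences within the five blocks of a word of `E10` agree. -/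
lemma block_add_eq_of_mem_E10 {ω : F} (h2 : (1 + 1 : F) = 0) (hω : ω ^ 2 = ω + 1)
    {c : Fin 10 → F} (hc : c ∈ E10 ω) (m : Fin 5) :
    c ⟨2 * m, by omega⟩ + c ⟨2 * m + 1, by omega⟩ = c 0 + c 1 := by
  have hωω : ω + (ω + 1) = 1 := by linear_combination ω * h2
  induction hc using Submodule.span_induction with
  | mem x hx =>
    simp only [Set.mem_insert_iff, Set.mem_singleton_iff] at hx
    rcases hx with rfl | rfl | rfl | rfl | rfl <;> fin_cases m <;> simp [h2, hω, hωω]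
  | zero => simp
  | add x y _ _ hx hy =>
    simp only [Pi.add_apply]
    linear_combination hx + hy
  | smul a x _ hx =>
    simp only [Pi.smul_apply, smul_eq_mul]
    linear_combination a * hx

/-- The words of weight 4 in `B10`, indexed by the omitted coordinate of their half. -/
def tetradB10 (ω : F) : Fin 10 → Fin 10 → F :=
  ![![0, 1, ω, ω + 1, 1, 0, 0, 0, 0, 0], ![1, 0, ω + 1, ω, 1, 0, 0, 0, 0, 0],
    ![1, ω, 0, ω + 1, ω + 1, 0, 0, 0, 0, 0], ![1, ω + 1, ω, 0, ω, 0, 0, 0, 0, 0],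
    ![1, 1, 1, 1, 0, 0, 0, 0, 0, 0],
    ![0, 0, 0, 0, 0, 0, 1, ω, ω + 1, 1], ![0, 0, 0, 0, 0, 1, 0, ω + 1, ω, 1],
    ![0, 0, 0, 0, 0, 1, ω, 0, ω + 1, ω + 1], ![0, 0, 0, 0, 0, 1, ω + 1, ω, 0, ω],
    ![0, 0, 0, 0, 0, 1, 1, 1, 1, 0]]

lemma tetradB10_mem {ω : F} (h2 : (1 + 1 : F) = 0) (hω : ω ^ 2 = ω + 1) (n : Fin 10) :
    tetradB10 ω n ∈ B10 ω := by
  have hg {x} (hx : x ∈ ({![1,1,1,1,0,0,0,0,0,0], ![0,1,ω,ω^2,1,0,0,0,0,0],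
    ![0,0,0,0,0,1,1,1,1,0], ![0,0,0,0,0,0,1,ω,ω^2,1],
    ![0,1,ω^2,ω,0,0,1,ω^2,ω,0]} : Set (Fin 10 → F))) : x ∈ B10 ω := Submodule.subset_span hx
  have hcomb : ∃ a b a' b' : F, tetradB10 ω n = a • ![1,1,1,1,0,0,0,0,0,0] +
      b • ![0,1,ω,ω^2,1,0,0,0,0,0] + a' • ![0,0,0,0,0,1,1,1,1,0] +
      b' • ![0,0,0,0,0,0,1,ω,ω^2,1] := by
    have e1 : 1 + ω = ω + 1 := add_comm _ _
    have e2 : 1 + ω * ω = ω := by linear_combination hω + h2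
    have e3 : 1 + ω * (ω + 1) = 0 := by linear_combination hω + (ω + 1) * h2
    have e4 : 1 + (ω + 1) = ω := by linear_combination h2
    have e5 : 1 + (ω + 1) * ω = 0 := by linear_combination hω + (ω + 1) * h2
    have e6 : 1 + (ω + 1) * (ω + 1) = ω + 1 := by linear_combination hω + (ω + 1) * h2
    let a : Fin 10 → F := ![0, 1, 1, 1, 1, 0, 0, 0, 0, 0]
    let b : Fin 10 → F := ![1, 1, ω + 1, ω, 0, 0, 0, 0, 0, 0]
    let a' : Fin 10 → F := ![0, 0, 0, 0, 0, 0, 1, 1, 1, 1]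
    let b' : Fin 10 → F := ![0, 0, 0, 0, 0, 1, 1, ω + 1, ω, 0]
    refine ⟨a n, b n, a' n, b' n, ?_⟩
    ext l
    fin_cases n <;> fin_cases l <;>
      simp [tetradB10, a, b, a', b', hω, h2, e1, e2, e3, e4, e5, e6]
  obtain ⟨a, b, a', b', h⟩ := hcomb
  rw [h]
  refine add_mem (add_mem (add_mem ?_ ?_) ?_) ?_ <;>
    exact Submodule.smul_mem _ _ (hg (by simp))

lemma tetradB10_eq_zero_iff {ω : F} (h0 : ω ≠ 0) (h1 : ω + 1 ≠ 0) (n l : Fin 10) :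
    tetradB10 ω n l = 0 ↔ l = n ∨ l.val / 5 ≠ n.val / 5 := by
  fin_cases n <;> fin_cases l <;> simp [tetradB10, h0, h1]

variable [DecidableEq F]

lemma phi_mem (ω x : F) : phi ω x = ![0, 0, 0, 0] ∨ phi ω x = ![0, 0, 1, 1] ∨
    phi ω x = ![0, 1, 0, 1] ∨ phi ω x = ![0, 1, 1, 0] := by
  unfold phi
  split_ifs <;> simp

lemma phi_mem_of_ne_zero (ω : F) {x : F} (hx : x ≠ 0) : phi ω x = ![0, 0, 1, 1] ∨
    phi ω x = ![0, 1, 0, 1] ∨ phi ω x = ![0, 1, 1, 0] := by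
  unfold phi
  split_ifs <;> simp_all

lemma phi_zero (ω : F) (k : Fin 4) : phi ω 0 k = 0 := by
  fin_cases k <;> simp [phi]

lemma hammingNorm_phi (ω x : F) : hammingNorm (phi ω x) = if x = 0 then 0 else 2 := by
  split_ifs with hx
  · simp [hx, hammingNorm_eq_sum, phi_zero]
  · simpa using column_weight_add_const _ 0 (phi_mem_of_ne_zero ω hx)

lemma d4ten0_subset_rhoB (ω : F) (C : Submodule F (Fin 10 → F)) :
    d4ten0 ⊆ rhoB ω (C : Set (Fin 10 → F)) := fun v hv =>
  ⟨0, ⟨0, C.zero_mem, by simp [phi_zero]⟩, v, hv, 0, by simp, by simp⟩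

lemma hatSet_subset_rhoB (ω : F) (C : Set (Fin 10 → F)) : hatSet ω C ⊆ rhoB ω C := fun v hv =>
  ⟨v, hv, 0, ⟨fun _ _ _ => rfl, by simp⟩, 0, by simp, by simp⟩

lemma exists_columns_of_mem_rhoB {ω : F} {C : Set (Fin 10 → F)} {v : Fin 40 → ZMod 2}
    (hv : v ∈ rhoB ω C) : ∃ c ∈ C, ∃ b : Fin 10 → ZMod 2,
      (∀ j k, v (idx j k) = phi ω (c j) k + b j) ∨
      (∀ j k, v (idx j k) = phi ω (c j) k + b j + eBvec (idx j k)) := by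
  obtain ⟨a, ⟨c, hc, ha⟩, b, ⟨hb, -⟩, e, he, rfl⟩ := hv
  refine ⟨c, hc, fun j => b (idx j 0), ?_⟩
  rcases he with rfl | rfl
  · exact Or.inl fun j k => by simp [ha, hb j k 0]
  · exact Or.inr fun j k => by simp [ha, hb j k 0]

lemma eBvec_column (j : Fin 10) : (fun k => eBvec (idx j k)) = ![1, 0, 0, 0] ∨
    (fun k => eBvec (idx j k)) = ![0, 1, 1, 1] := by
  revert j
  decide

/-- The words of weight 8 in `rhoB` do not involve `eBvec`. -/
lemma exists_columns_of_octad {ω : F} {C : Set (Fin 10 → F)} {v : Fin 40 → ZMod 2}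
    (hv : v ∈ rhoB ω C) (hw : hammingNorm v = 8) :
    ∃ c ∈ C, ∃ b : Fin 10 → ZMod 2, ∀ j k, v (idx j k) = phi ω (c j) k + b j := by
  obtain ⟨c, hc, b, h | h⟩ := exists_columns_of_mem_rhoB hv
  · exact ⟨c, hc, b, h⟩
  · have hj (j : Fin 10) : 1 ≤ hammingNorm fun k => v (idx j k) := by
      refine hammingNorm_pos_of_odd _ ?_
      have hp := column_parity_add_eB (phi ω (c j)) (b j) (phi_mem _ _)
      simp only [h]
      rcases eBvec_column j with he | he
      · simpa only [← he] using hp.1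
      · simpa only [← he] using hp.2
    have := Finset.sum_le_sum fun j (_ : j ∈ Finset.univ) => hj j
    rw [← hammingNorm_eq_sum_columns, hw] at this
    simp at this

/-- The first column. -/
def firstColumn : Fin 40 → ZMod 2 := fun i => if i.val < 4 then 1 else 0

/-- The word with columns 0011, 0011 in the first block and zero elsewhere. -/
def blockTetrad : Fin 40 → ZMod 2 := fun i =>
  if i.val = 2 ∨ i.val = 3 ∨ i.val = 6 ∨ i.val = 7 then 1 else 0

lemma orthOctads_firstColumn (ω : F) (C : Set (Fin 10 → F)) :
    OrthOctads (rhoB ω C) firstColumn := by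
  intro v hv hw
  obtain ⟨c, -, b, h⟩ := exists_columns_of_octad hv hw
  have h4 : ∀ (a : Fin 4 → ZMod 2) (b : ZMod 2),
      a = ![0, 0, 0, 0] ∨ a = ![0, 0, 1, 1] ∨ a = ![0, 1, 0, 1] ∨ a = ![0, 1, 1, 0] →
      ∑ k, (a k + b) * 1 = 0 := by decide
  rw [sum_eq_sum_columns, Finset.sum_eq_single 0]
  · rw [← h4 _ (b 0) (phi_mem ω (c 0))]
    refine Finset.sum_congr rfl fun k _ => ?_
    rw [h]
    have : firstColumn (idx 0 k) = 1 := by revert k; decide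
    rw [this]
  · intro j _ hj
    have : ∀ k, firstColumn (idx j k) = 0 := by revert j; decide
    simp [this]
  · simp

lemma orthOctads_blockTetrad {ω : F} (h2 : (1 + 1 : F) = 0) (hω : ω ^ 2 = ω + 1) :
    OrthOctads (rhoB ω (E10 ω : Set (Fin 10 → F))) blockTetrad := by
  intro v hv hw
  obtain ⟨c, hc, b, h⟩ := exists_columns_of_octad hv hw
  by_cases h01 : c 0 = c 1
  · have hz : ∀ j : Fin 10, j ≠ 0 → j ≠ 1 → ∀ k, blockTetrad (idx j k) = 0 := by decide
    have ht : ∀ (k : Fin 4), blockTetrad (idx 0 k) = ![0, 0, 1, 1] k ∧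
      blockTetrad (idx 1 k) = ![0, 0, 1, 1] k := by decide
    have hp : ∀ (a : Fin 4 → ZMod 2) (b b' : ZMod 2),
      ∑ k, (a k + b) * ![0, 0, 1, 1] k + ∑ k, (a k + b') * ![0, 0, 1, 1] k = 0 := by decide
    rw [sum_eq_sum_columns, Finset.sum_eq_add 0 1 (by decide)]
    · simp only [h, ht, h01]
      exact hp _ _ _
    · rintro j - ⟨h0, h1⟩
      simp [hz j h0 h1]
    · simp
    · simp
  · exfalso
    have hm (m : Fin 5) : 2 ≤ (hammingNorm fun k => v (idx ⟨2 * m, by omega⟩ k)) +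
        hammingNorm fun k => v (idx ⟨2 * m + 1, by omega⟩ k) := by
      have hb := block_add_eq_of_mem_E10 h2 hω hc m
      have hne : c 0 + c 1 ≠ 0 := fun h0 => h01 (by linear_combination h0 - c 1 * h2)
      rw [← hb] at hne
      simp only [h]
      by_cases hl : c ⟨2 * m, by omega⟩ = 0
      · rw [hl, zero_add] at hne
        rw [column_weight_add_const _ (b ⟨2 * m + 1, _⟩) (phi_mem_of_ne_zero ω hne)]
        exact Nat.le_add_left _ _
      · rw [column_weight_add_const _ (b ⟨2 * m, _⟩) (phi_mem_of_ne_zero ω hl)]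
        exact Nat.le_add_right _ _
    have hpair (f : Fin 10 → ℕ) :
        ∑ j, f j = ∑ m : Fin 5, (f ⟨2 * m, by omega⟩ + f ⟨2 * m + 1, by omega⟩) := by
      simp only [Fin.sum_univ_succ, Fin.sum_univ_zero]
      simp [Fin.succ, add_assoc]
    have hle := Finset.sum_le_sum fun m (_ : m ∈ Finset.univ) => hm m
    rw [hammingNorm_eq_sum_columns, hpair] at hw
    rw [hw] at hle
    simp at hle

lemma exists_weight_four_word_B10 {ω : F} (h2 : (1 + 1 : F) = 0) (hω : ω ^ 2 = ω + 1)
    {j j' : Fin 10} (hj : j' ≠ j) {x : F} (hx : x ≠ 0) :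
    ∃ c ∈ B10 ω, c j = x ∧ c j' = 0 ∧ ∑ l, (if c l = 0 then 0 else 2) = 8 := by
  have h0 : ω ≠ 0 := by
    rintro rfl
    simp at hω
  have h1 : ω + 1 ≠ 0 := fun h => h0 (by rw [h] at hω; exact pow_eq_zero_iff two_ne_zero |>.1 hω)
  have hn : ∀ j j' : Fin 10, j' ≠ j → ∃ n : Fin 10, ¬ (j = n ∨ j.val / 5 ≠ n.val / 5) ∧
      (j' = n ∨ j'.val / 5 ≠ n.val / 5) := by decide
  have hs : ∀ n : Fin 10, ∑ l : Fin 10, (if l = n ∨ l.val / 5 ≠ n.val / 5 then 0 else 2) = 8 := by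
    decide
  obtain ⟨n, hjn, hjn'⟩ := hn j j' hj
  rw [← tetradB10_eq_zero_iff h0 h1] at hjn hjn'
  refine ⟨(x / tetradB10 ω n j) • tetradB10 ω n,
    Submodule.smul_mem _ _ (tetradB10_mem h2 hω n), ?_, ?_, ?_⟩
  · simp [hjn]
  · simp [hjn']
  · simp only [Pi.smul_apply, smul_eq_mul, mul_eq_zero, div_eq_zero_iff, hx, hjn, false_or,
      tetradB10_eq_zero_iff h0 h1]
    exact hs n

/-- Words orthogonal to all octads of `rhoB` have columns of equal parity. -/
lemma column_parity_eq_of_orthOctads {ω : F} {C : Submodule F (Fin 10 → F)}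
    {T : Fin 40 → ZMod 2} (hT : OrthOctads (rhoB ω (C : Set (Fin 10 → F))) T) (j : Fin 10)
    (hj : j ≠ 0) : ∑ k, T (idx j k) = ∑ k, T (idx 0 k) := by
  let v := ofCols fun l _ => if l = 0 ∨ l = j then 1 else 0
  have hw : hammingNorm v = 8 := by
    simp only [hammingNorm_eq_sum_columns, v, ofCols_idx]
    revert j
    decide
  have h := hT v (d4ten0_subset_rhoB ω C
    ⟨fun _ _ _ => by simp only [v, ofCols_idx], by rw [hw]⟩) hw
  rw [sum_eq_sum_columns, Finset.sum_eq_add 0 j hj.symm] at h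
  · simp only [v, ofCols_idx, true_or, or_true, if_true, one_mul] at h
    rw [add_comm] at h
    exact CharTwo.add_eq_zero.1 h
  · rintro l - ⟨h0, h1⟩
    simp [v, ofCols_idx, h0, h1]
  · simp
  · simp

lemma mem_d4ten_of_orthOctads {ω : F} (h2 : (1 + 1 : F) = 0) (hω : ω ^ 2 = ω + 1)
    {T : Fin 40 → ZMod 2} (hT : OrthOctads (rhoB ω (B10 ω : Set (Fin 10 → F))) T)
    (hw : hammingNorm T = 4) : T ∈ d4ten := by
  have hpar (j : Fin 10) : ∑ k, T (idx j k) = ∑ k, T (idx 0 k) := by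
    by_cases hj : j = 0
    · rw [hj]
    · exact column_parity_eq_of_orthOctads hT j hj
  rw [hammingNorm_eq_sum_columns] at hw
  have heven (j : Fin 10) : ∑ k, T (idx j k) = 0 := by
    by_contra hj
    have := Finset.sum_le_sum fun l (_ : l ∈ Finset.univ) =>
      hammingNorm_pos_of_odd (fun k => T (idx l k)) (by rwa [hpar, ← hpar j])
    rw [hw] at this
    simp at this
  intro j
  refine (constant_or_weight_two _ (heven j)).resolve_right fun hj => ?_
  obtain ⟨j', hjj', hz⟩ : ∃ j', j' ≠ j ∧ ∀ l, l ≠ j → l ≠ j' → ∀ k, T (idx l k) = 0 := by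
    rw [← Finset.add_sum_erase _ _ (Finset.mem_univ j), hj] at hw
    obtain ⟨j', hj', hne⟩ : ∃ j' ∈ Finset.univ.erase j, (hammingNorm fun k => T (idx j' k)) ≠ 0 :=
      Finset.exists_ne_zero_of_sum_ne_zero (by omega)
    refine ⟨j', Finset.ne_of_mem_erase hj', fun l hl hl' k => ?_⟩
    rw [← Finset.add_sum_erase _ _ hj'] at hw
    have hle := Finset.single_le_sum (f := fun l => hammingNorm fun k => T (idx l k))
      (fun _ _ => Nat.zero_le _)
      (show l ∈ (Finset.univ.erase j).erase j' by simp [hl, hl'])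
    have heven' := even_hammingNorm _ (heven j')
    have h0 : (hammingNorm fun k => T (idx l k)) = 0 := by
      omega
    exact congrFun (hammingNorm_eq_zero.1 h0) k
  obtain ⟨x, hx, hxT⟩ : ∃ x : F, x ≠ 0 ∧ ∑ k, phi ω x k * T (idx j k) ≠ 0 := by
    have h0 : ω ≠ 0 := by
      rintro rfl
      simp at hω
    have h1 : ω ≠ 1 := by
      rintro rfl
      simp [h2] at hω
    rcases sum_mul_ne_zero_of_weight_two _ (heven j) hj with h | h
    · exact ⟨1, one_ne_zero, by simpa [phi] using h⟩
    · exact ⟨ω, h0, by simpa [phi, h0, h1] using h⟩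
  obtain ⟨c, hc, hcj, hcj', hc8⟩ := exists_weight_four_word_B10 h2 hω hjj' hx
  have horth := hT (ofCols fun l => phi ω (c l)) (hatSet_subset_rhoB _ _ ⟨c, hc, ofCols_idx _⟩) (by
    simp only [hammingNorm_eq_sum_columns, ofCols_idx]
    simpa only [hammingNorm_phi] using hc8)
  rw [sum_eq_sum_columns, Finset.sum_eq_single j] at horth
  · simp only [ofCols_idx, hcj] at horth
    exact hxT horth
  · intro l _ hl
    refine Finset.sum_eq_zero fun k _ => ?_
    rw [ofCols_idx]
    by_cases hl' : l = j'
    · rw [hl', hcj', phi_zero, zero_mul]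
    · rw [hz l hl hl', mul_zero]
  · simp

lemma four_dvd_hammingNorm_of_mem_d4ten {T : Fin 40 → ZMod 2} (hT : T ∈ d4ten) :
    4 ∣ hammingNorm T := by
  have h4 : ∀ u : Fin 4 → ZMod 2, (∀ k k', u k = u k') → 4 ∣ hammingNorm u := by decide
  rw [hammingNorm_eq_sum_columns]
  exact Finset.dvd_sum fun j _ => h4 _ (hT j)

end Inequivalence

/-- C₄₀,₁ᴰᴱ = ρ_B(E₁₀) and C₄₀,₂ᴰᴱ = ρ_B(B₁₀) are inequivalent:
no permutation of the 40 coordinates maps one onto the other. -/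
theorem stmt_19 (F : Type) [Field F] [Fintype F] [DecidableEq F]
    (hF : Fintype.card F = 4) (ω : F) (hω : ω ^ 2 = ω + 1) :
    ¬ ∃ σ : Equiv.Perm (Fin 40),
        (fun v : Fin 40 → ZMod 2 => v ∘ σ) '' (rhoB ω (E10 ω : Set (Fin 10 → F))) =
          rhoB ω (B10 ω : Set (Fin 10 → F)) := by
  rintro ⟨σ, hσ⟩
  have h2 : (1 + 1 : F) = 0 := by
    have h4 : ((4 : ℕ) : F) = 0 := by rw [← hF, FiniteField.cast_card_eq_zero]
    have h22 : (1 + 1 : F) ^ 2 = 0 := by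
      rw [← h4]
      norm_num
    exact pow_eq_zero_iff two_ne_zero |>.1 h22
  have hd {T : Fin 40 → ZMod 2} (hw : hammingNorm T = 4)
      (hT : OrthOctads (rhoB ω (E10 ω : Set (Fin 10 → F))) T) : T ∘ σ ∈ d4ten :=
    mem_d4ten_of_orthOctads h2 hω (hσ ▸ hT.comp_perm σ) (by rwa [hammingNorm_comp_perm])
  have hcol := hd (T := firstColumn) (by decide) (orthOctads_firstColumn _ _)
  have hblock := hd (T := blockTetrad) (by decide) (orthOctads_blockTetrad h2 hω)
  have hprod : (firstColumn * blockTetrad) ∘ σ ∈ d4ten := fun j k k' =>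
    congrArg₂ (· * ·) (hcol j k k') (hblock j k k')
  have hdvd := four_dvd_hammingNorm_of_mem_d4ten hprod
  rw [hammingNorm_comp_perm] at hdvd
  revert hdvd
  decide
end
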